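/- arXiv:2109.12797 — 3 statements merged into one kernel-verified Lean document; each statement's English description precedes it below -/
import Mathlib

section
/- (Proposition 1, RCAC update.) Let n ≥ 1 and let J_k be the retrospective cost. Define Φ_k ∈ ℝ^{2×n} with rows σ φ_{k−1} and φ_k, and R̄ = diag(R_z, R_u). Define sequences θ_k ∈ ℝ^n and P_k ∈ ℝ^{n×n} by the given θ_0 and positive definite P_0 and, for k ≥ 0, P_{k+1} = P_k − P_k Φ_k^T ( R̄^{−1} + Φ_k P_k Φ_k^T )^{−1} Φ_k P_k and θ_{k+1} = θ_k − σ P_{k+1} φ_{k−1}^T R_z [ g_k + σ( φ_{k−1} θ_k − u_{k−1} ) ] − P_{k+1} φ_k^T R_u φ_k θ_k. Then for every k ≥ 0, θ_{k+1} is the unique global minimizer of J_k over ℝ^n. -/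
open Matrix Finset

namespace Matrix

variable {m n : Type*} [Fintype m] [Fintype n] [DecidableEq n]

/-- The Woodbury form of a recursive least squares covariance update. -/
theorem PosDef.sub_mul_inv_mul_eq_inv [DecidableEq m] {P : Matrix n n ℝ} {R : Matrix m m ℝ}
    (hP : P.PosDef) (hR : R.PosDef) (B : Matrix m n ℝ) :
    P - P * Bᵀ * (R⁻¹ + B * P * Bᵀ)⁻¹ * B * P = (P⁻¹ + Bᵀ * R * B)⁻¹ := by
  have hinv : P⁻¹⁻¹ = P := nonsing_inv_nonsing_inv P ((isUnit_iff_isUnit_det P).1 hP.isUnit)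
  have hS : (R⁻¹ + B * P * Bᵀ).PosDef :=
    hR.inv.add_posSemidef (by simpa using hP.posSemidef.mul_mul_conjTranspose_same B)
  have h := add_mul_mul_inv_eq_sub P⁻¹ Bᵀ R B hP.inv.isUnit hR.isUnit
    (by rw [hinv]; exact hS.isUnit)
  rw [h, hinv]

theorem PosDef.inv_add_transpose_mul_mul {P : Matrix n n ℝ} {R : Matrix m m ℝ} (hP : P.PosDef)
    (hR : R.PosDef) (B : Matrix m n ℝ) : (P⁻¹ + Bᵀ * R * B).PosDef :=
  hP.inv.add_posSemidef (by simpa using hR.posSemidef.conjTranspose_mul_mul_same B)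

/-- Completing the square for a positive definite quadratic form. -/
theorem PosDef.dotProduct_mulVec_add_inv_mulVec {A : Matrix n n ℝ} (hA : A.PosDef)
    (d w : n → ℝ) :
    (d + A⁻¹ *ᵥ w) ⬝ᵥ (A *ᵥ (d + A⁻¹ *ᵥ w)) =
      d ⬝ᵥ (A *ᵥ d) + 2 * (w ⬝ᵥ d) + w ⬝ᵥ (A⁻¹ *ᵥ w) := by
  have hdet := (isUnit_iff_isUnit_det A).1 hA.isUnit
  have hsymm : Aᵀ = A := by simpa using hA.isHermitian.eq
  have hw : A *ᵥ (A⁻¹ *ᵥ w) = w := by rw [mulVec_mulVec, mul_nonsing_inv _ hdet, one_mulVec]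
  have hcross : (A⁻¹ *ᵥ w) ⬝ᵥ (A *ᵥ d) = w ⬝ᵥ d := by
    rw [dotProduct_mulVec, ← mulVec_transpose, hsymm, hw]
  rw [mulVec_add, hw, add_dotProduct, dotProduct_add, dotProduct_add, hcross,
    dotProduct_comm d w, dotProduct_comm _ w]
  ring

theorem dotProduct_transpose_mul_diagonal_mul_mulVec {k : ℕ} (a b : ℝ) (v w d : Fin k → ℝ) :
    d ⬝ᵥ (((of ![v, w])ᵀ * diagonal ![a, b] * of ![v, w]) *ᵥ d) =
      a * (v ⬝ᵥ d) ^ 2 + b * (w ⬝ᵥ d) ^ 2 := by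
  rw [← mulVec_mulVec, ← mulVec_mulVec, dotProduct_mulVec, vecMul_transpose]
  simp [dotProduct, mulVec, Fin.sum_univ_two, diagonal_apply]
  ring

end Matrix

/-- Proposition 1, RCAC update: With
P_{k+1} = P_k − P_k Φ_kᵀ (R̄⁻¹ + Φ_k P_k Φ_kᵀ)⁻¹ Φ_k P_k and
θ_{k+1} = θ_k − σ P_{k+1} φ_{k-1}ᵀ R_z [g_k + σ(φ_{k-1}θ_k − u_{k-1})]
          − P_{k+1} φ_kᵀ R_u φ_k θ_k,
for every k ≥ 0, θ_{k+1} is the unique global minimizer of the retrospective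
cost J_k over ℝ^n. -/
theorem rcac_update_minimizes_retrospective_cost
    (n : ℕ) (hn : 1 ≤ n)
    (φ : ℤ → (Fin n → ℝ)) (u : ℤ → ℝ) (g : ℕ → ℝ) (σ : ℝ)
    (Rz Ru : ℝ) (hRz : 0 < Rz) (hRu : 0 < Ru)
    (P0 : Matrix (Fin n) (Fin n) ℝ) (hP0 : P0.PosDef)
    (θ0 : Fin n → ℝ)
    (J : ℕ → (Fin n → ℝ) → ℝ)
    (hJ : ∀ (k : ℕ) (θ : Fin n → ℝ), J k θ =
      (∑ i ∈ Finset.range (k + 1),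
        (Rz * (g i + σ * (φ ((i : ℤ) - 1) ⬝ᵥ θ - u ((i : ℤ) - 1))) ^ 2
          + Ru * (φ (i : ℤ) ⬝ᵥ θ) ^ 2))
      + (θ - θ0) ⬝ᵥ (P0⁻¹ *ᵥ (θ - θ0)))
    (Φ : ℕ → Matrix (Fin 2) (Fin n) ℝ)
    (hΦ : ∀ i : ℕ, Φ i = Matrix.of ![σ • φ ((i : ℤ) - 1), φ (i : ℤ)])
    (Rbar : Matrix (Fin 2) (Fin 2) ℝ)
    (hRbar : Rbar = Matrix.diagonal ![Rz, Ru])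
    (P : ℕ → Matrix (Fin n) (Fin n) ℝ)
    (hPinit : P 0 = P0)
    (hPrec : ∀ k : ℕ, P (k + 1) =
      P k - P k * (Φ k)ᵀ * (Rbar⁻¹ + Φ k * P k * (Φ k)ᵀ)⁻¹ * Φ k * P k)
    (θ : ℕ → (Fin n → ℝ))
    (hθinit : θ 0 = θ0)
    (hθrec : ∀ k : ℕ, θ (k + 1) =
      θ k
      - (σ * Rz * (g k + σ * (φ ((k : ℤ) - 1) ⬝ᵥ θ k - u ((k : ℤ) - 1))))
          • (P (k + 1) *ᵥ φ ((k : ℤ) - 1))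
      - (Ru * (φ (k : ℤ) ⬝ᵥ θ k)) • (P (k + 1) *ᵥ φ (k : ℤ))) :
    ∀ k : ℕ,
      (∀ θ' : Fin n → ℝ, J k (θ (k + 1)) ≤ J k θ') ∧
      (∀ θs : Fin n → ℝ, (∀ θ' : Fin n → ℝ, J k θs ≤ J k θ') → θs = θ (k + 1)) := by
  have hR : Rbar.PosDef := by
    rw [hRbar, posDef_diagonal_iff]
    intro i
    fin_cases i <;> simpa
  have hstep : ∀ k, (P k).PosDef →
      P (k + 1) = ((P k)⁻¹ + (Φ k)ᵀ * Rbar * Φ k)⁻¹ := fun k hk => by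
    rw [hPrec, hk.sub_mul_inv_mul_eq_inv hR]
  have hP : ∀ k, (P k).PosDef := by
    intro k
    induction k with
    | zero => rwa [hPinit]
    | succ k ih =>
      rw [hstep k ih]
      exact (ih.inv_add_transpose_mul_mul hR _).inv
  have hcost : ∀ k, ∃ c, ∀ x,
      (∑ i ∈ Finset.range k,
        (Rz * (g i + σ * (φ ((i : ℤ) - 1) ⬝ᵥ x - u ((i : ℤ) - 1))) ^ 2
          + Ru * (φ (i : ℤ) ⬝ᵥ x) ^ 2))
      + (x - θ0) ⬝ᵥ (P0⁻¹ *ᵥ (x - θ0)) = c + (x - θ k) ⬝ᵥ ((P k)⁻¹ *ᵥ (x - θ k)) := by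
    intro k
    induction k with
    | zero => exact ⟨0, fun x => by simp [hPinit, hθinit]⟩
    | succ k ih =>
      obtain ⟨c, hc⟩ := ih
      set z := g k + σ * (φ ((k : ℤ) - 1) ⬝ᵥ θ k - u ((k : ℤ) - 1)) with hz
      set w := (σ * Rz * z) • φ ((k : ℤ) - 1) + (Ru * (φ (k : ℤ) ⬝ᵥ θ k)) • φ (k : ℤ) with hw
      have hA := (hP k).inv_add_transpose_mul_mul hR (Φ k)
      refine ⟨c + Rz * z ^ 2 + Ru * (φ (k : ℤ) ⬝ᵥ θ k) ^ 2 - w ⬝ᵥ (P (k + 1) *ᵥ w),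
        fun x => ?_⟩
      have hx : x - θ (k + 1) = (x - θ k) + P (k + 1) *ᵥ w := by
        rw [hθrec, hw, mulVec_add, mulVec_smul, mulVec_smul]
        abel
      have hwd : w ⬝ᵥ (x - θ k) = σ * Rz * z * (φ ((k : ℤ) - 1) ⬝ᵥ (x - θ k))
          + Ru * (φ (k : ℤ) ⬝ᵥ θ k) * (φ (k : ℤ) ⬝ᵥ (x - θ k)) := by
        rw [hw, add_dotProduct, smul_dotProduct, smul_dotProduct, smul_eq_mul, smul_eq_mul]
      have hquad := dotProduct_transpose_mul_diagonal_mul_mulVec Rz Ru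
        (σ • φ ((k : ℤ) - 1)) (φ (k : ℤ)) (x - θ k)
      rw [← hΦ, ← hRbar, smul_dotProduct, smul_eq_mul] at hquad
      rw [Finset.sum_range_succ, add_right_comm, hc, hx, hstep k (hP k),
        nonsing_inv_nonsing_inv _ ((isUnit_iff_isUnit_det _).1 hA.isUnit),
        hA.dotProduct_mulVec_add_inv_mulVec, add_mulVec, dotProduct_add, hquad, hwd]
      simp only [dotProduct_sub, hz]
      ring
  intro k
  obtain ⟨c, hc⟩ := hcost (k + 1)
  have hJc : ∀ x, J k x = c + (x - θ (k + 1)) ⬝ᵥ ((P (k + 1))⁻¹ *ᵥ (x - θ (k + 1))) :=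
    fun x => (hJ k x).trans (hc x)
  have hmin : J k (θ (k + 1)) = c := by simp [hJc]
  have hlt : ∀ x, x ≠ θ (k + 1) → J k (θ (k + 1)) < J k x := fun x hx => by
    have h := (hP (k + 1)).inv.dotProduct_mulVec_pos (sub_ne_zero.2 hx)
    rw [star_trivial] at h
    rw [hmin, hJc]
    linarith
  refine ⟨fun x => ?_, fun x hx => ?_⟩
  · rcases eq_or_ne x (θ (k + 1)) with rfl | h
    · exact le_rfl
    · exact (hlt x h).le
  · by_contra h
    exact (hlt x h).not_ge (hx _)
end

section
/- (Guidance law, trapezoidal case, regularity and monotonicity.) Let a_max > 0, v_max > 0, and d ≥ v_max²/a_max, and let q be the trapezoidal distance profile on [0, T_f]. Then q is continuous on [0, T_f] and strictly increasing on [0, T_f]; in particular 0 ≤ q(t) ≤ d for all t ∈ [0, T_f]. -/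
/-- Guidance law, trapezoidal case, regularity and monotonicity:
the trapezoidal distance profile q is continuous and strictly increasing on
[0, T_f]; in particular 0 ≤ q(t) ≤ d for all t ∈ [0, T_f]. -/
theorem guidance_trapezoidal_regularity
    (amax vmax d : ℝ) (ha : 0 < amax) (hv : 0 < vmax) (hd0 : 0 < d)
    (hd : vmax ^ 2 / amax ≤ d)
    (T1 T2 Tf : ℝ) (hT1 : T1 = vmax / amax) (hT2 : T2 = d / vmax)
    (hTf : Tf = T1 + T2)
    (q : ℝ → ℝ)
    (hq : ∀ t : ℝ, q t =
      if t < T1 then amax * t ^ 2 / 2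
      else if t < T2 then amax * T1 ^ 2 / 2 + vmax * (t - T1)
      else amax * T1 ^ 2 / 2 + vmax * (T2 - T1) + vmax * (t - T2)
        - amax * (t - T2) ^ 2 / 2) :
    ContinuousOn q (Set.Icc 0 Tf) ∧
    StrictMonoOn q (Set.Icc 0 Tf) ∧
    ∀ t ∈ Set.Icc 0 Tf, 0 ≤ q t ∧ q t ≤ d := by
  have hT1pos : 0 < T1 := hT1 ▸ div_pos hv ha
  have hvT : vmax = amax * T1 := by rw [hT1]; field_simp
  have hdT : d = vmax * T2 := by rw [hT2]; field_simp
  have hT12 : T1 ≤ T2 := by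
    rw [hT1, hT2, div_le_div_iff₀ ha hv]
    rw [div_le_iff₀ ha] at hd
    linarith
  have hcont : Continuous q := by
    have hq' : q = fun t => if T1 ≤ t then
        (if T2 ≤ t then amax * T1 ^ 2 / 2 + vmax * (T2 - T1) + vmax * (t - T2)
          - amax * (t - T2) ^ 2 / 2
        else amax * T1 ^ 2 / 2 + vmax * (t - T1)) else amax * t ^ 2 / 2 := by
      funext t
      rw [hq t]
      split_ifs <;> first | rfl | (exfalso; linarith)
    rw [hq']
    refine Continuous.if_le (Continuous.if_le (by fun_prop) (by fun_prop) continuous_const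
      continuous_id ?_) (by fun_prop) continuous_const continuous_id ?_
    · rintro t rfl
      ring
    · rintro t rfl
      split_ifs with h
      · obtain rfl := le_antisymm hT12 h
        ring
      · ring
  have hmono : StrictMonoOn q (Set.Icc 0 Tf) := by
    rintro s ⟨hs0, -⟩ t ⟨-, htf⟩ hst
    have accel : ∀ x y : ℝ, 0 ≤ x → x < y → amax * x ^ 2 / 2 < amax * y ^ 2 / 2 := by
      intro x y hx hxy
      gcongr
    have cruise : ∀ x y : ℝ, x ≤ y → 0 ≤ vmax * (y - x) := fun x y hxy =>
      mul_nonneg hv.le (sub_nonneg.2 hxy)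
    have brake : ∀ x y : ℝ, x < y → y ≤ T1 →
        vmax * x - amax * x ^ 2 / 2 < vmax * y - amax * y ^ 2 / 2 := by
      intro x y hxy hy
      have h : 0 < amax * ((y - x) * (T1 - (x + y) / 2)) :=
        mul_pos ha (mul_pos (by linarith) (by linarith))
      rw [hvT]
      linarith
    have brake_nonneg : T2 ≤ t → 0 ≤ vmax * (t - T2) - amax * (t - T2) ^ 2 / 2 := by
      intro h
      rcases h.eq_or_lt with rfl | h
      · simp
      · have := brake 0 (t - T2) (by linarith) (by linarith)
        linarith
    rw [hq s, hq t]
    split_ifs with h₁ h₂ h₃ h₄ h₅ h₆ h₇ <;> try (exfalso; linarith)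
    · exact accel s t hs0 hst
    · linarith [accel s T1 hs0 h₁, cruise T1 t (by linarith)]
    · linarith [accel s T1 hs0 h₁, cruise T1 T2 hT12, brake_nonneg (by linarith)]
    · linarith [mul_lt_mul_of_pos_left hst hv]
    · have hsT : s < T2 := by assumption
      linarith [mul_lt_mul_of_pos_left hsT hv, brake_nonneg (by linarith)]
    · linarith [brake (s - T2) (t - T2) (by linarith) (by linarith)]
  have hq0 : q 0 = 0 := by
    rw [hq, if_pos hT1pos]
    ring
  have hqf : q Tf = d := by
    rw [hq, if_neg (by linarith), if_neg (by linarith), hTf, hdT, hvT]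
    ring
  refine ⟨hcont.continuousOn, hmono, fun t ht => ?_⟩
  have hTf0 : 0 ≤ Tf := ht.1.trans ht.2
  exact ⟨hq0 ▸ hmono.monotoneOn (Set.left_mem_Icc.2 hTf0) ht ht.1,
    hqf ▸ hmono.monotoneOn ht (Set.right_mem_Icc.2 hTf0) ht.2⟩
end

section
/- (Guidance law, trapezoidal case, speed constraint.) Let a_max > 0, v_max > 0, and d ≥ v_max²/a_max, and let q be the trapezoidal distance profile on [0, T_f]. Then q is differentiable on (0, T_f) with derivative q'(t) = a_max t on (0, T_1), q'(t) = v_max on [T_1, T_2], and q'(t) = v_max − a_max (t − T_2) on (T_2, T_f); consequently q' is continuous, 0 ≤ q'(t) ≤ v_max for all t ∈ (0, T_f), and the one-sided derivatives of q at 0 and at T_f are both 0. -/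
/-- The squared positive part is differentiable, with derivative twice the positive part. -/
lemma hasDerivAt_max_zero_sq (x : ℝ) :
    HasDerivAt (fun y : ℝ => max y 0 ^ 2) (2 * max x 0) x := by
  have away : ∀ y : ℝ, y ≠ 0 → HasDerivAt (fun y : ℝ => max y 0 ^ 2) (2 * max y 0) y := by
    intro y hy
    rcases lt_or_gt_of_ne hy with h | h
    · rw [max_eq_right h.le, mul_zero]
      refine (hasDerivAt_const y (0 : ℝ)).congr_of_eventuallyEq ?_
      filter_upwards [Iio_mem_nhds h] with z hz
      simp [max_eq_right (Set.mem_Iio.mp hz).le]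
    · rw [max_eq_left h.le]
      refine HasDerivAt.congr_of_eventuallyEq (f := fun z : ℝ => z ^ 2) ?_ ?_
      · simpa using hasDerivAt_pow 2 y
      · filter_upwards [Ioi_mem_nhds h] with z hz
        simp [max_eq_left (Set.mem_Ioi.mp hz).le]
  rcases eq_or_ne x 0 with rfl | hx
  · exact hasDerivAt_of_hasDerivAt_of_ne away (by fun_prop)
      (g := fun y : ℝ => 2 * max y 0) (by fun_prop)
  · exact away x hx

/-- Guidance law, trapezoidal case, speed constraint:
the trapezoidal distance profile q is differentiable on (0, T_f) with derivative
q'(t) = a_max t on (0, T₁), q'(t) = v_max on [T₁, T₂] and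
q'(t) = v_max − a_max(t − T₂) on (T₂, T_f); q' is continuous,
0 ≤ q'(t) ≤ v_max on (0, T_f), and the one-sided derivatives of q at 0 and at
T_f are both 0. -/
theorem guidance_trapezoidal_speed_constraint
    (amax vmax d : ℝ) (ha : 0 < amax) (hv : 0 < vmax) (hd0 : 0 < d)
    (hd : vmax ^ 2 / amax ≤ d)
    (T1 T2 Tf : ℝ) (hT1 : T1 = vmax / amax) (hT2 : T2 = d / vmax)
    (hTf : Tf = T1 + T2)
    (q : ℝ → ℝ)
    (hq : ∀ t : ℝ, q t =
      if t < T1 then amax * t ^ 2 / 2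
      else if t < T2 then amax * T1 ^ 2 / 2 + vmax * (t - T1)
      else amax * T1 ^ 2 / 2 + vmax * (T2 - T1) + vmax * (t - T2)
        - amax * (t - T2) ^ 2 / 2)
    (q' : ℝ → ℝ)
    (hq' : ∀ t : ℝ, q' t =
      if t < T1 then amax * t
      else if t ≤ T2 then vmax
      else vmax - amax * (t - T2)) :
    (∀ t ∈ Set.Ioo 0 Tf, HasDerivAt q (q' t) t) ∧
    ContinuousOn q' (Set.Ioo 0 Tf) ∧
    (∀ t ∈ Set.Ioo 0 Tf, 0 ≤ q' t ∧ q' t ≤ vmax) ∧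
    HasDerivWithinAt q 0 (Set.Ici 0) 0 ∧
    HasDerivWithinAt q 0 (Set.Iic Tf) Tf := by
  have hvT : amax * T1 = vmax := by rw [hT1]; field_simp
  have hT1pos : 0 < T1 := by rw [hT1]; positivity
  have hT12 : T1 ≤ T2 := by
    rw [hT1, hT2, div_le_div_iff₀ ha hv]
    rw [div_le_iff₀ ha] at hd
    nlinarith
  have q_eq : q = fun t => amax / 2 * (t ^ 2 - max (t - T1) 0 ^ 2 - max (t - T2) 0 ^ 2) := by
    funext t
    rw [hq t, ← hvT]
    split_ifs with h₁ h₂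
    · rw [max_eq_right (by linarith), max_eq_right (by linarith)]; ring
    · rw [max_eq_left (by linarith), max_eq_right (by linarith)]; ring
    · rw [max_eq_left (by linarith), max_eq_left (by linarith)]; ring
  have q'_eq : q' = fun t => amax * (t - max (t - T1) 0 - max (t - T2) 0) := by
    funext t
    rw [hq' t, ← hvT]
    split_ifs with h₁ h₂
    · rw [max_eq_right (by linarith), max_eq_right (by linarith)]; ring
    · rw [max_eq_left (by linarith), max_eq_right (by linarith)]; ring
    · rw [max_eq_left (by linarith), max_eq_left (by linarith)]; ring
  have deriv_q : ∀ t, HasDerivAt q (q' t) t := by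
    intro t
    have pos_part (c : ℝ) :
        HasDerivAt (fun s : ℝ => max (s - c) 0 ^ 2) (2 * max (t - c) 0) t :=
      (hasDerivAt_max_zero_sq (t - c)).comp_sub_const t c
    rw [q_eq, q'_eq]
    refine ((((hasDerivAt_pow 2 t).fun_sub (pos_part T1)).fun_sub (pos_part T2)).const_mul
      (amax / 2)).congr_deriv ?_
    push_cast
    ring
  refine ⟨fun t _ => deriv_q t, ?_, ?_, ?_, ?_⟩
  · rw [q'_eq]
    fun_prop
  · rintro t ⟨h0, hf⟩
    rw [hq' t]
    split_ifs with h₁ h₂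
    · constructor <;> nlinarith
    · exact ⟨hv.le, le_rfl⟩
    · constructor <;> nlinarith
  · have h : q' 0 = 0 := by rw [hq' 0, if_pos hT1pos, mul_zero]
    simpa only [h] using (deriv_q 0).hasDerivWithinAt (s := Set.Ici 0)
  · have h : q' Tf = 0 := by
      rw [hq' Tf, if_neg (by linarith), if_neg (by linarith), hTf, ← hvT]
      ring
    simpa only [h] using (deriv_q Tf).hasDerivWithinAt (s := Set.Iic Tf)
end
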